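/- If x is a harmonic bounded operator on F, then for all words I, J : List Θ the operator (r_J)* x r_I is harmonic: P_ω((r_J)* ∘ x ∘ r_I) = (r_J)* ∘ x ∘ r_I. -/

import Mathlib

open Filter Topology

noncomputable section

/-- The full Fock space over a Hilbert space with orthonormal basis indexed by `Θ`,
realized as `ℓ²(List Θ)`. -/
abbrev Fock (Θ : Type*) : Type _ := lp (fun _ : List Θ => ℂ) 2

/-- The canonical orthonormal basis vector `e_I` of the Fock space, indexed by a word
`I : List Θ`.  The vacuum vector is `Ω = fockBasis []`. -/
noncomputable def fockBasis {Θ : Type*} [DecidableEq Θ] (I : List Θ) : Fock Θ :=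
  lp.single 2 I 1

/-- For a word `I = [i₁, …, i_k]`, `wordOp r I = r i₁ ∘L ⋯ ∘L r i_k`, the identity for the
empty word.  Applied to the right (resp. left) creation operators, this gives `r_I`
(resp. `l_I`). -/
noncomputable def wordOp {Θ : Type*} (r : Θ → Fock Θ →L[ℂ] Fock Θ) :
    List Θ → (Fock Θ →L[ℂ] Fock Θ)
  | [] => 1
  | i :: I => r i ∘L wordOp r I

theorem fock_ext {Θ : Type*} [DecidableEq Θ] {A B : Fock Θ →L[ℂ] Fock Θ}
    (h : ∀ K, A (fockBasis K) = B (fockBasis K)) : A = B := by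
  ext1 v
  have hv := lp.hasSum_single (E := fun _ : List Θ => ℂ) (p := 2) (by norm_num) v
  have key : ∀ K, A (lp.single 2 K (v K)) = B (lp.single 2 K (v K)) := by
    intro K
    have : (lp.single 2 K (v K) : Fock Θ) = (v K) • fockBasis K := by
      rw [fockBasis, ← lp.single_smul]; simp
    rw [this, map_smul, map_smul, h]
  have hA := A.hasSum hv
  have hB := B.hasSum hv
  simp only [key] at hA
  exact hA.unique hB

theorem fock_isom {Θ : Type*} [DecidableEq Θ] (T : Fock Θ →L[ℂ] Fock Θ) (i : Θ)
    (hT : ∀ (I : List Θ), T (fockBasis I) = fockBasis (i :: I)) :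
    ContinuousLinearMap.adjoint T ∘L T = 1 := by
  apply fock_ext
  intro K
  ext M
  have h (w : Fock Θ) : w M = inner ℂ (fockBasis M) w := by
    rw [fockBasis, lp.inner_single_left]; simp
  rw [h, h, ContinuousLinearMap.comp_apply, ContinuousLinearMap.adjoint_inner_right, hT, hT]
  simp only [fockBasis, lp.inner_single_left, ContinuousLinearMap.one_apply]
  simp [lp.single_apply, Pi.single_apply]

theorem fock_norm {Θ : Type*} [DecidableEq Θ] (T : Fock Θ →L[ℂ] Fock Θ) (i : Θ)
    (hT : ∀ (I : List Θ), T (fockBasis I) = fockBasis (i :: I)) : ‖T‖ ≤ 1 := by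
  have h := (ContinuousLinearMap.norm_map_iff_adjoint_comp_self T).2 (fock_isom T i hT)
  exact T.opNorm_le_bound zero_le_one (fun v => by rw [h, one_mul])

theorem word_comm {Θ : Type*} (T : Fock Θ →L[ℂ] Fock Θ) (r : Θ → Fock Θ →L[ℂ] Fock Θ)
    (h : ∀ j, T ∘L r j = r j ∘L T) (J : List Θ) : T ∘L wordOp r J = wordOp r J ∘L T := by
  induction J with
  | nil => rfl
  | cons j J ih =>
    simp only [wordOp]
    rw [← ContinuousLinearMap.comp_assoc, h, ContinuousLinearMap.comp_assoc, ih,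
      ContinuousLinearMap.comp_assoc]

/-- If `x` is harmonic, then for all words `I, J` the operator
`(r_J)* x r_I` is harmonic. -/
theorem statement4 {Θ : Type*} [Countable Θ] [Nonempty Θ] [DecidableEq Θ]
    (l r : Θ → Fock Θ →L[ℂ] Fock Θ)
    (hl : ∀ (i : Θ) (I : List Θ), l i (fockBasis I) = fockBasis (i :: I))
    (hr : ∀ (i : Θ) (I : List Θ), r i (fockBasis I) = fockBasis (I ++ [i]))
    (ω : Θ → ℝ) (hω : ∀ i, 0 < ω i) (hω1 : ∑' i, ω i = 1)
    (P : (Fock Θ →L[ℂ] Fock Θ) → (Fock Θ →L[ℂ] Fock Θ))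
    (hP : ∀ (x : Fock Θ →L[ℂ] Fock Θ) (v : Fock Θ),
      P x v = ∑' i, (ω i : ℂ) • ((ContinuousLinearMap.adjoint (l i) ∘L x ∘L l i) v))
    (x : Fock Θ →L[ℂ] Fock Θ) (hx : P x = x) (I J : List Θ) :
    P (ContinuousLinearMap.adjoint (wordOp r J) ∘L x ∘L wordOp r I)
      = ContinuousLinearMap.adjoint (wordOp r J) ∘L x ∘L wordOp r I := by
  have hc : ∀ i J, l i ∘L wordOp r J = wordOp r J ∘L l i := fun i J =>
    word_comm (l i) r (fun j => fock_ext fun K => by simp [hl, hr]) J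
  have hsω : Summable ω := by
    by_contra hn
    rw [tsum_eq_zero_of_not_summable hn] at hω1
    exact zero_ne_one hω1
  ext1 v
  rw [hP]
  set w := wordOp r I v with hw
  have hs : Summable fun i =>
      (ω i : ℂ) • ((ContinuousLinearMap.adjoint (l i) ∘L x ∘L l i) w) := by
    refine Summable.of_norm_bounded (g := fun i => ω i * (‖x‖ * ‖w‖)) (hsω.mul_right _) ?_
    intro i
    have h1 := fock_norm (l i) i (hl i)
    have h2 : ‖ContinuousLinearMap.adjoint (l i)‖ ≤ 1 := by
      rw [LinearIsometryEquiv.norm_map]; exact h1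
    rw [norm_smul, Complex.norm_real, Real.norm_of_nonneg (hω i).le]
    refine mul_le_mul_of_nonneg_left ?_ (hω i).le
    calc ‖ContinuousLinearMap.adjoint (l i) (x (l i w))‖
        ≤ 1 * ‖x (l i w)‖ := ContinuousLinearMap.le_of_opNorm_le _ h2 _
      _ ≤ 1 * (‖x‖ * (1 * ‖w‖)) := by
        gcongr
        exact (x.le_opNorm _).trans (by gcongr; exact ContinuousLinearMap.le_of_opNorm_le _ h1 _)
      _ = ‖x‖ * ‖w‖ := by ring
  have hxw := hP x w
  rw [hx] at hxw
  rw [ContinuousLinearMap.comp_apply, ContinuousLinearMap.comp_apply, ← hw, hxw,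
    ContinuousLinearMap.map_tsum _ hs]
  refine tsum_congr fun i => ?_
  rw [map_smul]
  congr 1
  have e1 : wordOp r I (l i v) = l i w := (DFunLike.congr_fun (hc i I) v).symm
  have e2 := congrArg ContinuousLinearMap.adjoint (hc i J)
  rw [ContinuousLinearMap.adjoint_comp, ContinuousLinearMap.adjoint_comp] at e2
  simp only [ContinuousLinearMap.comp_apply, e1]
  exact (DFunLike.congr_fun e2 (x (l i w))).symm
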